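/- Let X be a compact metric space, f : X → X continuous, and φ : X → ℝ continuous. If ∫ φ dμ > λ for every f-invariant Borel probability measure μ, then there exists a positive integer N such that for all n ≥ N and all x ∈ X, (1/n) · Σ_{i=0}^{n-1} φ(f^i(x)) > λ. -/

import Mathlib

open MeasureTheory Filter Topology

/-- The uniform probability measure on the first `n` points of the `f`-orbit of `x`. -/
noncomputable def empiricalMeasure {X : Type*} [MeasurableSpace X] (f : X → X) (n : ℕ) (x : X) :
    Measure X :=
  (n : ENNReal)⁻¹ • ∑ i ∈ Finset.range n, Measure.dirac (f^[i] x)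

theorem isProbabilityMeasure_empiricalMeasure {X : Type*} [MeasurableSpace X] (f : X → X)
    {n : ℕ} (hn : n ≠ 0) (x : X) : IsProbabilityMeasure (empiricalMeasure f n x) := by
  constructor
  simp [empiricalMeasure, ENNReal.inv_mul_cancel, hn]

theorem integral_empiricalMeasure {X : Type*} [TopologicalSpace X] [CompactSpace X]
    [MeasurableSpace X] [OpensMeasurableSpace X] (f : X → X) (n : ℕ) (x : X)
    {g : X → ℝ} (hg : Continuous g) :
    ∫ y, g y ∂(empiricalMeasure f n x) = (n : ℝ)⁻¹ * ∑ i ∈ Finset.range n, g (f^[i] x) := by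
  have hm : StronglyMeasurable g := (BoundedContinuousFunction.mkOfCompact ⟨g, hg⟩).continuous
    |>.stronglyMeasurable
  rw [empiricalMeasure, integral_smul_measure, integral_finsetSum_measure]
  · simp [integral_dirac' _ _ hm]
  · intro i _
    exact (BoundedContinuousFunction.mkOfCompact ⟨g, hg⟩).integrable _

/-- Replacing `g` by `g ∘ f` changes a Birkhoff average of length `n` by `O(1 / n)`. -/
theorem tendsto_birkhoff_average_comp_sub {X : Type*} [TopologicalSpace X] [CompactSpace X]
    (f : X → X) {g : X → ℝ} (hg : Continuous g) {n : ℕ → ℕ} (hn : Tendsto n atTop atTop)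
    (x : ℕ → X) :
    Tendsto (fun k ↦ ((n k : ℝ)⁻¹ * ∑ i ∈ Finset.range (n k), g (f (f^[i] (x k)))) -
      (n k : ℝ)⁻¹ * ∑ i ∈ Finset.range (n k), g (f^[i] (x k))) atTop (𝓝 0) := by
  let G := BoundedContinuousFunction.mkOfCompact ⟨g, hg⟩
  have hlim : Tendsto (fun k ↦ (n k : ℝ)⁻¹ * (2 * ‖G‖)) atTop (𝓝 0) := by
    simpa using (tendsto_inv_atTop_nhds_zero_nat (𝕜 := ℝ)).comp hn |>.mul_const (2 * ‖G‖)
  refine squeeze_zero_norm (fun k ↦ ?_) hlim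
  have htel : ∑ i ∈ Finset.range (n k), g (f (f^[i] (x k))) -
      ∑ i ∈ Finset.range (n k), g (f^[i] (x k)) = g (f^[n k] (x k)) - g (x k) := by
    rw [← Finset.sum_sub_distrib]
    simpa [Function.iterate_succ_apply'] using
      Finset.sum_range_sub (fun i ↦ g (f^[i] (x k))) (n k)
  rw [← mul_sub, htel, norm_mul, norm_inv, RCLike.norm_natCast]
  gcongr
  calc ‖g (f^[n k] (x k)) - g (x k)‖ ≤ ‖g (f^[n k] (x k))‖ + ‖g (x k)‖ := norm_sub_le _ _
    _ ≤ ‖G‖ + ‖G‖ := add_le_add (G.norm_coe_le_norm _) (G.norm_coe_le_norm _)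
    _ = 2 * ‖G‖ := by ring

/-- **Krylov–Bogolyubov**: along an ultrafilter, empirical measures of growing length converge to
an invariant probability measure. -/
theorem exists_invariant_measure_tendsto_birkhoff_average {X : Type*} [MetricSpace X]
    [CompactSpace X] [MeasurableSpace X] [BorelSpace X] {f : X → X} (hf : Continuous f)
    {n : ℕ → ℕ} (hn0 : ∀ k, n k ≠ 0) (hn : Tendsto n atTop atTop) (x : ℕ → X)
    (U : Ultrafilter ℕ) (hU : (U : Filter ℕ) ≤ atTop) :
    ∃ μ : Measure X, IsProbabilityMeasure μ ∧ Measure.map f μ = μ ∧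
      ∀ g : X → ℝ, Continuous g → Tendsto
        (fun k ↦ (n k : ℝ)⁻¹ * ∑ i ∈ Finset.range (n k), g (f^[i] (x k))) U
        (𝓝 (∫ y, g y ∂μ)) := by
  let P : ℕ → ProbabilityMeasure X := fun k ↦
    ⟨empiricalMeasure f (n k) (x k), isProbabilityMeasure_empiricalMeasure f (hn0 k) (x k)⟩
  obtain ⟨μ, -, hμ⟩ := isCompact_univ.ultrafilter_le_nhds (U.map P) (by simp)
  have hP : Tendsto P U (𝓝 μ) := hμ
  have hlim : ∀ g : X → ℝ, Continuous g → Tendsto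
      (fun k ↦ (n k : ℝ)⁻¹ * ∑ i ∈ Finset.range (n k), g (f^[i] (x k))) U
      (𝓝 (∫ y, g y ∂(μ : Measure X))) := by
    intro g hg
    have := ProbabilityMeasure.tendsto_iff_forall_integral_tendsto.1 hP
      (BoundedContinuousFunction.mkOfCompact ⟨g, hg⟩)
    simpa [P, integral_empiricalMeasure f _ _ hg] using this
  refine ⟨μ, inferInstance, ?_, hlim⟩
  have := Measure.isProbabilityMeasure_map (μ := (μ : Measure X)) hf.aemeasurable
  refine ext_of_forall_integral_eq_of_IsFiniteMeasure fun g ↦ ?_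
  rw [integral_map hf.aemeasurable g.continuous.aestronglyMeasurable]
  have hdiff := (hlim _ (g.continuous.comp hf)).sub (hlim g g.continuous)
  exact sub_eq_zero.1 (tendsto_nhds_unique hdiff
    ((tendsto_birkhoff_average_comp_sub f g.continuous hn x).mono_left hU))

/-- If the integral of a continuous function `φ` is `> λ` for every `f`-invariant
Borel probability measure on a compact metric space, then there is a positive
integer `N` such that all Birkhoff averages of length `n ≥ N` are `> λ`,
uniformly in the starting point. -/
theorem stmt_3 {X : Type*} [MetricSpace X] [CompactSpace X]
    [MeasurableSpace X] [BorelSpace X]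
    (f : X → X) (hf : Continuous f) (φ : X → ℝ) (hφ : Continuous φ) (lam : ℝ)
    (h : ∀ μ : Measure X, IsProbabilityMeasure μ → Measure.map f μ = μ →
      ∫ x, φ x ∂μ > lam) :
    ∃ N : ℕ, 0 < N ∧ ∀ n ≥ N, ∀ x : X,
      (1 / (n : ℝ)) * ∑ i ∈ Finset.range n, φ (f^[i] x) > lam := by
  by_contra! hcon
  choose n hn x hx using fun k : ℕ ↦ hcon (k + 1) k.succ_pos
  have hn_top : Tendsto n atTop atTop :=
    tendsto_atTop_mono (fun k ↦ (Nat.le_succ k).trans (hn k)) tendsto_id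
  obtain ⟨μ, hμ, hinv, hlim⟩ := exists_invariant_measure_tendsto_birkhoff_average hf
    (fun k ↦ (k.succ_pos.trans_le (hn k)).ne') hn_top x (Ultrafilter.of atTop)
    (Ultrafilter.of_le atTop)
  refine (h μ hμ hinv).not_ge (le_of_tendsto' (hlim φ hφ) fun k ↦ ?_)
  simpa only [one_div] using hx k
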